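/- Estimate of the expected Taylor remainder of the SRK approximation: Let p∈ℕ, let f∈C_P^{2p+2}(ℝ^d,ℝ), and suppose b^0=a, b^1,…,b^m are (2p+2)-times continuously differentiable with ‖b^k(x)‖ ≤ C_1(1+‖x‖), globally bounded first-order derivatives, and all higher partial derivatives up to order 2p+2 of polynomial growth. Let θ_ι(h)=√h·ϑ_ι with |ϑ_ι| ≤ C_ϑ almost surely, θ_0(h)=h, and assume that almost surely the stage equations possess solutions depending (2p+2)-times continuously differentiably on θ on the segment joining 0 and θ(h), with starting value x_0∈ℝ^d. Then there exist h_0>0 and a function K∈C_P^0(ℝ^d,ℝ) such that for every h∈(0,h_0) and every (0,1)-valued random variable ξ: | E( Σ_{ν_1,…,ν_{2p+2}∈M̄} Δθ_{ν_1}⋯Δθ_{ν_{2p+2}} · ∂^{2p+2} f(A(t_0,x_0,θ))/(∂θ_{ν_1}⋯∂θ_{ν_{2p+2}}) evaluated at θ = ξ·θ(h) ) | ≤ K(x_0)·h^{p+1}, where Δθ_ν = θ_ν(h) and A(t_0,x_0,θ) denotes the one-step value as a function of θ. -/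

import Mathlib

open scoped BigOperators
open Finset MeasureTheory ProbabilityTheory

noncomputable section

namespace SRKPaper

/-- `ℝ^d` with the Euclidean norm. -/
abbrev Evec (d : ℕ) : Type := EuclideanSpace ℝ (Fin d)

/-- The index pairs `(k,ν)` of the SRK method: `det` is `(0,0)`,
`sto k ν` is `(k,ν)` with `k ∈ {1,…,m}`, `ν ∈ M`. -/
inductive SIdx (m : ℕ) (M : Type) : Type where
  | det : SIdx m M
  | sto : Fin m → M → SIdx m M

/-- `M̄ = M ∪ {0}`, with `none` playing the role of the index `0`. -/
abbrev Mbar (M : Type) : Type := Option M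

/-- The real coefficients of an autonomous `s`-stage stochastic Runge–Kutta method. -/
structure SRK (m s : ℕ) (M : Type) : Type where
  α : Fin s → ℝ
  γc : M → SIdx m M → Fin s → ℝ
  A : SIdx m M → Fin s → Fin s → ℝ
  B : M → SIdx m M → Fin m → M → Fin s → Fin s → ℝ

variable {d m s : ℕ} {M : Type}

section SRKdefs
variable [Fintype M]

/-- θ-dependent weights `z^{(k,ν)}`. -/
def SRK.z (c : SRK m s M) (θ : Mbar M → ℝ) : SIdx m M → Fin s → ℝ
  | .det => fun i => c.α i * θ none
  | .sto k ν => fun i => ∑ ι : M, c.γc ι (.sto k ν) i * θ (some ι)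

/-- θ-dependent stage coefficients `Z^{(k,ν),(r,μ)}`; the first index is the
father pair `p = (k,ν)`, the second the son pair. -/
def SRK.Z (c : SRK m s M) (θ : Mbar M → ℝ) (p : SIdx m M) : SIdx m M → Fin s → Fin s → ℝ
  | .det => fun i j => c.A p i j * θ none
  | .sto r μ => fun i j => ∑ ι : M, c.B ι p r μ i j * θ (some ι)

/-- The stage equations of the autonomous SRK method with starting value `y0`. -/
def StageEq (c : SRK m s M) (a : Evec d → Evec d) (b : Fin m → Evec d → Evec d)
    (y0 : Evec d) (θ : Mbar M → ℝ) (H : SIdx m M → Fin s → Evec d) : Prop :=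
  ∀ (p : SIdx m M) (i : Fin s),
    H p i = y0 + (∑ j, c.Z θ p .det i j • a (H .det j))
      + ∑ j, ∑ r, ∑ μ, c.Z θ p (.sto r μ) i j • b r (H (.sto r μ) j)

/-- The one-step value `Y(t)` of the SRK method. -/
def oneStep (c : SRK m s M) (a : Evec d → Evec d) (b : Fin m → Evec d → Evec d)
    (y0 : Evec d) (θ : Mbar M → ℝ) (H : SIdx m M → Fin s → Evec d) : Evec d :=
  y0 + (∑ i, c.z θ .det i • a (H .det i))
    + ∑ i, ∑ k, ∑ ν, c.z θ (.sto k ν) i • b k (H (.sto k ν) i)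

end SRKdefs

/-- A monotonically labelled S-tree with `l+1` nodes: node `0` is the root, the
nonroot nodes are labelled `1,…,l` and are represented by `Fin l` (node `i : Fin l`
has true label `i+1`).  `father i` is the father of node `i+1` (a node label in
`Fin (l+1)`), and `color i` is the colour of node `i+1`: `none` is a deterministic
node `τ`, `some j` a stochastic node `σ_j` with (concrete) variable index `j`. -/
structure STree (l m : ℕ) : Type where
  father : Fin l → Fin (l + 1)
  color : Fin l → Option (Fin m)
  mono : ∀ i : Fin l, (father i).val ≤ i.val

def STree.equivSubtype (l m : ℕ) :
    STree l m ≃ {p : (Fin l → Fin (l+1)) × (Fin l → Option (Fin m)) //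
      ∀ i : Fin l, (p.1 i).val ≤ i.val} where
  toFun t := ⟨(t.father, t.color), t.mono⟩
  invFun p := ⟨p.1.1, p.1.2, p.2⟩
  left_inv t := rfl
  right_inv p := rfl

instance (l m : ℕ) : Fintype (STree l m) := Fintype.ofEquiv _ (STree.equivSubtype l m).symm

/-- The set of sons of the node with label `v`. -/
def STree.child {l m : ℕ} (t : STree l m) (v : Fin (l+1)) : Finset (Fin l) :=
  Finset.univ.filter fun i => t.father i = v

/-- interpretation of a colour by the corresponding coefficient function (`b^0 = a`). -/
def nodeFun (a : Evec d → Evec d) (b : Fin m → Evec d → Evec d) :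
    Option (Fin m) → Evec d → Evec d
  | none => a
  | some j => b j

/-- The elementary differential attached to the subtree rooted at the nonroot node `i`
(fuel-based recursion; the fuel `l` always suffices). -/
def elemFAux (a : Evec d → Evec d) (b : Fin m → Evec d → Evec d) {l : ℕ} (t : STree l m) :
    ℕ → Fin l → Evec d → Evec d
  | 0, _, _ => 0
  | fuel + 1, i, x =>
      iteratedFDeriv ℝ (t.child i.succ).card (nodeFun a b (t.color i)) x
        fun p => elemFAux a b t fuel ((t.child i.succ).orderIsoOfFin rfl p).1 x

def elemF (a : Evec d → Evec d) (b : Fin m → Evec d → Evec d) {l : ℕ} (t : STree l m)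
    (i : Fin l) : Evec d → Evec d := elemFAux a b t l i

/-- The elementary differential `F(t)(x)` of a tree whose root has colour `γ`
(representing the functional `f`). -/
def elemFRoot (f : Evec d → ℝ) (a : Evec d → Evec d) (b : Fin m → Evec d → Evec d)
    {l : ℕ} (t : STree l m) (x : Evec d) : ℝ :=
  iteratedFDeriv ℝ (t.child 0).card f x
    fun p => elemF a b t ((t.child 0).orderIsoOfFin rfl p).1 x

/-- The elementary differential `F(t)(x)` of a tree whose root has colour `rc`
(`none = τ`, `some j = σ_j`). -/
def elemFRootV (a : Evec d → Evec d) (b : Fin m → Evec d → Evec d) (rc : Option (Fin m))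
    {l : ℕ} (t : STree l m) (x : Evec d) : Evec d :=
  iteratedFDeriv ℝ (t.child 0).card (nodeFun a b rc) x
    fun p => elemF a b t ((t.child 0).orderIsoOfFin rfl p).1 x

/-- number of nodes of the subtree rooted at the nonroot node `i` (fuel-based). -/
def sizeAux {l m : ℕ} (t : STree l m) : ℕ → Fin l → ℕ
  | 0, _ => 0
  | fuel + 1, i => 1 + ∑ c ∈ t.child i.succ, sizeAux t fuel c

def STree.size {l m : ℕ} (t : STree l m) (i : Fin l) : ℕ := sizeAux t l i

/-- density of the subtree rooted at the nonroot node `i`. -/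
def densAux {l m : ℕ} (t : STree l m) : ℕ → Fin l → ℕ
  | 0, _ => 1
  | fuel + 1, i => t.size i * ∏ c ∈ t.child i.succ, densAux t fuel c

def STree.densNode {l m : ℕ} (t : STree l m) (i : Fin l) : ℕ := densAux t l i

/-- density `γ(t)` of a tree whose root has colour `γ`. -/
def STree.densDelta {l m : ℕ} (t : STree l m) : ℕ := ∏ c ∈ t.child 0, t.densNode c

/-- density `γ(t)` of a tree (with `l+1` nodes) whose root has colour `τ` or `σ_j`. -/
def STree.densR {l m : ℕ} (t : STree l m) : ℕ := (l+1) * ∏ c ∈ t.child 0, t.densNode c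

/-- number `s(t)` of stochastic nonroot nodes. -/
def STree.scount {l m : ℕ} (t : STree l m) : ℕ :=
  (Finset.univ.filter fun i : Fin l => (t.color i).isSome = true).card

/-- number `d(t)` of deterministic nonroot nodes. -/
def STree.dcount {l m : ℕ} (t : STree l m) : ℕ :=
  (Finset.univ.filter fun i : Fin l => t.color i = none).card

section PhiDefs
variable [Fintype M]

/-- The vector `Ψ^{(p)}` of the subtree rooted at the nonroot node `i`, where `p` is
the index pair of the father of `i` (fuel-based recursion). -/
def PsiAux (c : SRK m s M) (θ : Mbar M → ℝ) {l : ℕ} (t : STree l m) :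
    ℕ → Fin l → SIdx m M → Fin s → ℝ
  | 0, _, _, _ => 1
  | fuel + 1, i, p, q =>
    match t.color i with
    | none => ∑ j, c.Z θ p .det q j * ∏ cc ∈ t.child i.succ, PsiAux c θ t fuel cc .det j
    | some jj => ∑ μ : M, ∑ j, c.Z θ p (.sto jj μ) q j *
        ∏ cc ∈ t.child i.succ, PsiAux c θ t fuel cc (.sto jj μ) j

def PsiN (c : SRK m s M) (θ : Mbar M → ℝ) {l : ℕ} (t : STree l m)
    (i : Fin l) (p : SIdx m M) (q : Fin s) : ℝ := PsiAux c θ t l i p q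

/-- the elementary-weight factor contributed by the subtree rooted at a son of the root. -/
def phiFactor (c : SRK m s M) (θ : Mbar M → ℝ) {l : ℕ} (t : STree l m) (i : Fin l) : ℝ :=
  match t.color i with
  | none => ∑ j, c.z θ .det j * ∏ cc ∈ t.child i.succ, PsiN c θ t cc .det j
  | some jj => ∑ μ : M, ∑ j, c.z θ (.sto jj μ) j *
      ∏ cc ∈ t.child i.succ, PsiN c θ t cc (.sto jj μ) j

/-- The elementary weight `Φ_S(t)` of a `γ`-rooted tree. -/
def PhiS (c : SRK m s M) (θ : Mbar M → ℝ) {l : ℕ} (t : STree l m) : ℝ :=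
  ∏ i ∈ t.child 0, phiFactor c θ t i

/-- `∑_{i₁} Z^{(k,ν)}_{i,i₁} Φ_{i₁}(t)` for a tree with root colour `rc`, the sum over
the pair `(j_r,ν_r)` of the root being shared between the `Z`-factor and `Φ`. -/
def ZPhi (c : SRK m s M) (θ : Mbar M → ℝ) (p : SIdx m M) (i : Fin s)
    (rc : Option (Fin m)) {l : ℕ} (t : STree l m) : ℝ :=
  match rc with
  | none => ∑ i1, c.Z θ p .det i i1 * ∏ cc ∈ t.child 0, PsiN c θ t cc .det i1
  | some jr => ∑ ν : M, ∑ i1, c.Z θ p (.sto jr ν) i i1 *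
      ∏ cc ∈ t.child 0, PsiN c θ t cc (.sto jr ν) i1

/-- `∑_{i₁} z_{i₁} Φ_{i₁}(t)` for a tree with root colour `rc`. -/
def zPhi (c : SRK m s M) (θ : Mbar M → ℝ)
    (rc : Option (Fin m)) {l : ℕ} (t : STree l m) : ℝ :=
  match rc with
  | none => ∑ i1, c.z θ .det i1 * ∏ cc ∈ t.child 0, PsiN c θ t cc .det i1
  | some jr => ∑ ν : M, ∑ i1, c.z θ (.sto jr ν) i1 *
      ∏ cc ∈ t.child 0, PsiN c θ t cc (.sto jr ν) i1

end PhiDefs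

/-- `D^q` with increments `Δ` applied to `g` at the point `θ0`:
`∑_{ν₁,…,ν_q ∈ M̄} Δθ_{ν₁}⋯Δθ_{ν_q} ∂^q g/(∂θ_{ν₁}⋯∂θ_{ν_q})(θ0)`. -/
def Dq {ι : Type} [Fintype ι] [DecidableEq ι] {F : Type}
    [NormedAddCommGroup F] [NormedSpace ℝ F]
    (q : ℕ) (Δ : ι → ℝ) (g : (ι → ℝ) → F) (θ0 : ι → ℝ) : F :=
  ∑ νs : Fin q → ι, (∏ r, Δ (νs r)) •
    iteratedFDeriv ℝ q g θ0 fun r => Pi.single (νs r) 1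

/-- `∑_{ν₁,…,ν_q ∈ M̄} ∂^q g/(∂θ_{ν₁}⋯∂θ_{ν_q})(θ0)`. -/
def DerSum {ι : Type} [Fintype ι] [DecidableEq ι] {F : Type}
    [NormedAddCommGroup F] [NormedSpace ℝ F]
    (q : ℕ) (g : (ι → ℝ) → F) (θ0 : ι → ℝ) : F :=
  ∑ νs : Fin q → ι, iteratedFDeriv ℝ q g θ0 fun r => Pi.single (νs r) 1

/-- the space `C_P^l`: `l` times continuously differentiable with all derivatives up
to order `l` of polynomial growth. -/
def IsCP {d : ℕ} {F : Type} [NormedAddCommGroup F] [NormedSpace ℝ F]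
    (l : ℕ) (g : Evec d → F) : Prop :=
  ContDiff ℝ l g ∧ ∀ i : ℕ, i ≤ l → ∃ K > (0:ℝ), ∃ r : ℕ,
    ∀ x, ‖iteratedFDeriv ℝ i g x‖ ≤ K * (1 + ‖x‖ ^ (2*r))

/-- A labelled tree is special if no node except possibly the root has more than one son. -/
def IsSpecial {q : ℕ} (t : STree q 0) : Prop :=
  ∀ i : Fin q, (t.child i.succ).card ≤ 1

instance {q : ℕ} : DecidablePred (IsSpecial (q := q)) := fun t => by
  unfold IsSpecial; infer_instance

end SRKPaper

namespace SRKPaper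

section RemainderAux

open Filter Topology

variable {E F G : Type} [NormedAddCommGroup E] [NormedSpace ℝ E]
  [NormedAddCommGroup F] [NormedSpace ℝ F] [NormedAddCommGroup G] [NormedSpace ℝ G]

/-- If near `t` the function `u` takes at each point either the value of `v` or `0`, then its
derivative at `t` is either that of `v` or `0`. -/
lemma hasDerivAt_eq_or_eq_zero {u v : ℝ → F} {u' v' : F} {t : ℝ}
    (hu : HasDerivAt u u' t) (hv : HasDerivAt v v' t)
    (h : ∀ᶠ y in 𝓝 t, u y = v y ∨ u y = 0) : u' = v' ∨ u' = 0 := by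
  by_contra! hne
  have h1 := (hu.sub hv).eventually_ne (c := 0) (sub_ne_zero.2 hne.1)
  have h2 := hu.eventually_ne (c := 0) hne.2
  obtain ⟨y, hy1, hy2, hy3⟩ := (h1.and (h2.and (h.filter_mono nhdsWithin_le_nhds))).exists
  rcases hy3 with hy3 | hy3
  · exact hy1 (by simp [hy3])
  · exact hy2 hy3

/-- The diagonal iterated derivative of `g` along a line on which `g` is smooth is either the
one-variable derivative or the junk value `0`, without any regularity of `g` off the line. -/
lemma iteratedFDeriv_diag_eq_or_eq_zero (g : E → F) (v : E) {n : ℕ} {I : Set ℝ} (hI : IsOpen I)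
    (hg : ContDiffOn ℝ n (fun t : ℝ => g (t • v)) I) {k : ℕ} (hk : k ≤ n) :
    ∀ t ∈ I, iteratedFDeriv ℝ k g (t • v) (fun _ => v)
        = iteratedDerivWithin k (fun t : ℝ => g (t • v)) I t ∨
      iteratedFDeriv ℝ k g (t • v) (fun _ => v) = 0 := by
  induction k with
  | zero => intro t _; left; simp
  | succ k ih =>
    intro t ht
    by_cases hd : DifferentiableAt ℝ (iteratedFDeriv ℝ k g) (t • v)
    · have hline : HasDerivAt (fun y : ℝ => y • v) v t := by
        simpa using (hasDerivAt_id t).smul_const v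
      have h1 := (hd.hasFDerivAt.comp_hasDerivAt t hline)
      have h2 : HasDerivAt (fun y : ℝ => iteratedFDeriv ℝ k g (y • v) (fun _ => v))
          (iteratedFDeriv ℝ (k + 1) g (t • v) (fun _ => v)) t :=
        ((ContinuousMultilinearMap.apply ℝ (fun _ : Fin k => E) F
          (fun _ => v)).hasFDerivAt.comp_hasDerivAt t h1)
      have h3 : HasDerivAt (iteratedDerivWithin k (fun t : ℝ => g (t • v)) I)
          (iteratedDerivWithin (k + 1) (fun t : ℝ => g (t • v)) I t) t := by
        rw [iteratedDerivWithin_succ]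
        exact ((hg.differentiableOn_iteratedDerivWithin (by exact_mod_cast hk)
          hI.uniqueDiffOn) t ht).hasDerivWithinAt.hasDerivAt (hI.mem_nhds ht)
      refine hasDerivAt_eq_or_eq_zero h2 h3 ?_
      filter_upwards [hI.mem_nhds ht] with y hy using ih (by omega) y hy
    · right
      rw [iteratedFDeriv_succ_apply_left, fderiv_zero_of_not_differentiableAt hd]
      simp

lemma iteratedFDeriv_diag_eq_sum {ι : Type} [Fintype ι] [DecidableEq ι] (q : ℕ) (v : ι → ℝ)
    (g : (ι → ℝ) → ℝ) (θ : ι → ℝ) :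
    ∑ νs : Fin q → ι, (∏ r, v (νs r)) * iteratedFDeriv ℝ q g θ (fun r => Pi.single (νs r) 1)
      = iteratedFDeriv ℝ q g θ (fun _ => v) := by
  conv_rhs => rw [pi_eq_sum_univ' v]
  rw [ContinuousMultilinearMap.map_sum]
  refine Finset.sum_congr rfl fun νs _ => ?_
  rw [ContinuousMultilinearMap.map_smul_univ, smul_eq_mul]

lemma iteratedDerivWithin_succ_id_smul {V : ℝ → F} {I : Set ℝ} (hI : IsOpen I) {k : ℕ}
    (hV : ContDiffOn ℝ (k + 1 : ℕ) V I) :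
    ∀ t ∈ I, iteratedDerivWithin (k + 1) (fun t : ℝ => t • V t) I t
      = t • iteratedDerivWithin (k + 1) V I t + ((k : ℝ) + 1) • iteratedDerivWithin k V I t := by
  have hder : ∀ {j : ℕ}, j < k + 1 → ∀ t ∈ I, HasDerivWithinAt (iteratedDerivWithin j V I)
      (iteratedDerivWithin (j + 1) V I t) I t := by
    intro j hj t ht
    rw [iteratedDerivWithin_succ]
    exact ((hV.differentiableOn_iteratedDerivWithin (by exact_mod_cast hj)
      hI.uniqueDiffOn) t ht).hasDerivWithinAt
  induction k with
  | zero =>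
    intro t ht
    have h0 := hder (j := 0) (by omega) t ht
    rw [iteratedDerivWithin_zero] at h0
    rw [iteratedDerivWithin_succ, iteratedDerivWithin_zero, iteratedDerivWithin_zero]
    have := ((hasDerivWithinAt_id t I).smul h0).derivWithin (hI.uniqueDiffOn t ht)
    simpa [Pi.smul_def'] using this
  | succ k ih =>
    intro t ht
    have ih' := ih (hV.of_le (by exact_mod_cast Nat.le_succ _)) (fun hj => hder (by omega))
    rw [iteratedDerivWithin_succ]
    have h1 := (((hasDerivWithinAt_id t I).smul (hder (j := k + 1) (by omega) t ht)).add
      ((hder (j := k) (by omega) t ht).const_smul ((k : ℝ) + 1)))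
    have h2 := (h1.congr (f₁ := iteratedDerivWithin (k + 1) (fun t : ℝ => t • V t) I)
      ih' (ih' t ht)).derivWithin (hI.uniqueDiffOn t ht)
    rw [h2]
    push_cast
    simp only [id, one_smul]
    module

lemma norm_iteratedDerivWithin_comp_le {g : E → F} {u : ℝ → E} {I : Set ℝ} (hI : IsOpen I)
    {k : ℕ} (hg : ContDiff ℝ k g) (hu : ContDiffOn ℝ k u I) {t A D : ℝ} (ht : t ∈ I)
    (hA : ∀ i ≤ k, ‖iteratedFDeriv ℝ i g (u t)‖ ≤ A)
    (hD : ∀ i, 1 ≤ i → i ≤ k → ‖iteratedDerivWithin i u I t‖ ≤ D ^ i) :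
    ‖iteratedDerivWithin k (fun y => g (u y)) I t‖ ≤ k.factorial * A * D ^ k := by
  rw [← norm_iteratedFDerivWithin_eq_norm_iteratedDerivWithin]
  refine norm_iteratedFDerivWithin_comp_le (N := k) (t := Set.univ) hg.contDiffOn hu le_rfl
    uniqueDiffOn_univ hI.uniqueDiffOn (Set.mapsTo_univ _ _) ht ?_ ?_
  · simpa [iteratedFDerivWithin_univ] using hA
  · intro i h1 h2
    rw [norm_iteratedFDerivWithin_eq_norm_iteratedDerivWithin]
    exact hD i h1 h2

/-- The derivative of order `k + 1` of a composition, with the term containing the derivative of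
top order of the inner function split off. -/
lemma norm_iteratedDerivWithin_succ_comp_le {g : E → F} {u : ℝ → E} {I : Set ℝ} (hI : IsOpen I)
    {k : ℕ} (hg : ContDiff ℝ (k + 1 : ℕ) g) (hu : ContDiffOn ℝ (k + 1 : ℕ) u I)
    {t A D L : ℝ} (ht : t ∈ I) (hA0 : 0 ≤ A) (hD0 : 0 ≤ D)
    (hL : ‖fderiv ℝ g (u t)‖ ≤ L)
    (hA : ∀ i ≤ k + 1, ‖iteratedFDeriv ℝ i g (u t)‖ ≤ A)
    (hD : ∀ i, 1 ≤ i → i ≤ k → ‖iteratedDerivWithin i u I t‖ ≤ D ^ i) :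
    ‖iteratedDerivWithin (k + 1) (fun y => g (u y)) I t‖
      ≤ L * ‖iteratedDerivWithin (k + 1) u I t‖ + 2 ^ k * k.factorial * A * D ^ (k + 1) := by
  have hg' : ContDiff ℝ k (fderiv ℝ g) := hg.fderiv_right (by push_cast; exact le_rfl)
  have huk : ContDiffOn ℝ k u I := hu.of_le (by exact_mod_cast Nat.le_succ k)
  have hu' : ContDiffOn ℝ k (derivWithin u I) I :=
    hu.derivWithin hI.uniqueDiffOn (by push_cast; exact le_rfl)
  have hcongr : Set.EqOn (derivWithin (fun y => g (u y)) I)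
      (fun y => (fderiv ℝ g (u y)) (derivWithin u I y)) I := by
    intro y hy
    have h1 : DifferentiableAt ℝ g (u y) :=
      (hg.differentiable (by simp)) _
    have h2 := (hu.differentiableOn (by simp)) y hy
    exact (h1.hasFDerivAt.comp_hasDerivWithinAt y h2.hasDerivWithinAt).derivWithin
      (hI.uniqueDiffOn y hy)
  rw [iteratedDerivWithin_succ', iteratedDerivWithin_congr hcongr ht,
    ← norm_iteratedFDerivWithin_eq_norm_iteratedDerivWithin]
  refine (norm_iteratedFDerivWithin_clm_apply (N := k) (hg'.comp_contDiffOn huk) hu'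
    hI.uniqueDiffOn ht le_rfl).trans ?_
  rw [Finset.sum_range_succ', add_comm]
  simp only [norm_iteratedFDerivWithin_eq_norm_iteratedDerivWithin]
  refine add_le_add ?_ ?_
  · simp only [Nat.choose_zero_right, Nat.cast_one, one_mul, iteratedDerivWithin_zero,
      Nat.sub_zero, iteratedDerivWithin_succ', Function.comp_apply]
    gcongr
  · have hterm : ∀ i ∈ Finset.range k, (k.choose (i + 1) : ℝ) *
        ‖iteratedDerivWithin (i + 1) (fderiv ℝ g ∘ u) I t‖ *
        ‖iteratedDerivWithin (k - (i + 1)) (derivWithin u I) I t‖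
        ≤ (k.choose (i + 1) : ℝ) * (k.factorial * A * D ^ (k + 1)) := by
      intro i hi
      have hik : i + 1 ≤ k := Finset.mem_range.1 hi
      have h1 : ‖iteratedDerivWithin (i + 1) (fderiv ℝ g ∘ u) I t‖
          ≤ (i + 1).factorial * A * D ^ (i + 1) := by
        refine norm_iteratedDerivWithin_comp_le hI (hg'.of_le (by exact_mod_cast hik))
          (huk.of_le (by exact_mod_cast hik)) ht ?_ (fun j h1 h2 => hD j h1 (h2.trans hik))
        intro j hj
        rw [norm_iteratedFDeriv_fderiv]
        exact hA _ (by omega)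
      have h2 : ‖iteratedDerivWithin (k - (i + 1)) (derivWithin u I) I t‖
          ≤ D ^ (k - (i + 1) + 1) := by
        rw [← iteratedDerivWithin_succ']
        exact hD _ (by omega) (by omega)
      have hf : ((i + 1).factorial : ℝ) ≤ k.factorial := by
        exact_mod_cast Nat.factorial_le hik
      rw [mul_assoc]
      refine mul_le_mul_of_nonneg_left ?_ (by positivity)
      calc _ ≤ ((i + 1).factorial * A * D ^ (i + 1)) * D ^ (k - (i + 1) + 1) :=
            mul_le_mul h1 h2 (norm_nonneg _) (by positivity)
        _ = (i + 1).factorial * A * D ^ (k + 1) := by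
            rw [mul_assoc, ← pow_add]; congr 2; omega
        _ ≤ _ := by gcongr
    refine (Finset.sum_le_sum hterm).trans ?_
    rw [← Finset.sum_mul]
    have hsum : (∑ i ∈ Finset.range k, (k.choose (i + 1) : ℝ)) ≤ 2 ^ k := by
      have h := Nat.sum_range_choose k
      rw [Finset.sum_range_succ'] at h
      have h' : (∑ i ∈ Finset.range k, k.choose (i + 1)) ≤ 2 ^ k := by omega
      exact_mod_cast h'
    calc _ ≤ (2 : ℝ) ^ k * (k.factorial * A * D ^ (k + 1)) := by gcongr
      _ = _ := by ring

/-- The constants in the bound for the derivatives of the stages along the segment. -/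
def stageConst (w A : ℝ) : ℕ → ℝ
  | 0 => 1
  | k + 1 => w * (2 ^ k * k.factorial + (k + 1) * k.factorial) * A * stageConst w A k ^ (k + 1)

lemma one_le_stageConst {w A : ℝ} (hw : 1 ≤ w) (hA : 1 ≤ A) (k : ℕ) : 1 ≤ stageConst w A k := by
  induction k with
  | zero => exact le_rfl
  | succ k ih =>
    have hf : (1 : ℝ) ≤ k.factorial := by exact_mod_cast Nat.succ_le_of_lt k.factorial_pos
    have h1 : (1 : ℝ) ≤ 2 ^ k * k.factorial + (k + 1) * k.factorial := by
      have := one_le_mul_of_one_le_of_one_le (one_le_pow₀ (n := k) one_le_two) hf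
      have : (0 : ℝ) ≤ (k + 1) * k.factorial := by positivity
      linarith
    exact one_le_mul_of_one_le_of_one_le (one_le_mul_of_one_le_of_one_le
      (one_le_mul_of_one_le_of_one_le hw h1) hA) (one_le_pow₀ ih)

lemma stageConst_le_succ {w A : ℝ} (hw : 1 ≤ w) (hA : 1 ≤ A) (k : ℕ) :
    stageConst w A k ≤ stageConst w A (k + 1) := by
  have h0 := one_le_stageConst hw hA k
  have hf : (1 : ℝ) ≤ k.factorial := by exact_mod_cast Nat.succ_le_of_lt k.factorial_pos
  have h1 : (1 : ℝ) ≤ 2 ^ k * k.factorial + (k + 1) * k.factorial := by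
    have := one_le_mul_of_one_le_of_one_le (one_le_pow₀ (n := k) one_le_two) hf
    have : (0 : ℝ) ≤ (k + 1) * k.factorial := by positivity
    linarith
  have h2 := one_le_mul_of_one_le_of_one_le (one_le_mul_of_one_le_of_one_le hw h1) hA
  calc stageConst w A k ≤ stageConst w A k ^ (k + 1) := le_self_pow₀ h0 (by omega)
    _ ≤ _ := le_mul_of_one_le_left (by positivity) h2

lemma exists_stageConst_eq (w : ℝ) (k : ℕ) :
    ∃ (c : ℝ) (e : ℕ), ∀ A : ℝ, stageConst w A k = c * A ^ e := by
  induction k with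
  | zero => exact ⟨1, 0, fun A => by simp [stageConst]⟩
  | succ k ih =>
    obtain ⟨c, e, h⟩ := ih
    refine ⟨w * (2 ^ k * k.factorial + (k + 1) * k.factorial) * c ^ (k + 1), 1 + e * (k + 1),
      fun A => ?_⟩
    rw [stageConst, h]
    ring

variable {Q : Type} [Fintype Q]

lemma norm_sum_smul_le {W : Q → ℝ} {v : Q → E} {w B : ℝ} (hW : ∀ q, |W q| ≤ w)
    (hv : ∀ q, ‖v q‖ ≤ B) (hw : 0 ≤ w) : ‖∑ q, W q • v q‖ ≤ Fintype.card Q * w * B := by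
  calc ‖∑ q, W q • v q‖ ≤ ∑ q, ‖W q • v q‖ := norm_sum_le _ _
    _ ≤ ∑ _q : Q, w * B := by
        refine Finset.sum_le_sum fun q _ => ?_
        rw [norm_smul, Real.norm_eq_abs]
        exact mul_le_mul (hW q) (hv q) (norm_nonneg _) hw
    _ = _ := by simp [mul_assoc]

variable [Nonempty Q]

/-- A quantity that is at most half of the maximum of the family plus a constant, for every member
of a finite family, is bounded by twice that constant. -/
lemma le_two_mul_of_le_half_max {x : Q → ℝ} {R : ℝ}
    (h : ∀ (B : ℝ), (∀ q, x q ≤ B) → (∃ q, B = x q) → ∀ q, x q ≤ B / 2 + R) (q : Q) :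
    x q ≤ 2 * R := by
  obtain ⟨q0, hq0⟩ := Finite.exists_max x
  have h1 := h (x q0) hq0 ⟨q0, rfl⟩ q0
  have h2 := hq0 q
  linarith

lemma norm_stage_le {Fn : Q → E → E} {u : Q → E} {W : Q → Q → ℝ} {x0 : E} {w C t : ℝ}
    (ht : t ∈ Set.Icc (0 : ℝ) 1) (hw : 0 ≤ w) (hC : 0 ≤ C) (hW : ∀ q q', |W q q'| ≤ w)
    (hsmall : Fintype.card Q * w * C ≤ 1 / 2)
    (hgrow : ∀ q x, ‖Fn q x‖ ≤ C * (1 + ‖x‖))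
    (heq : ∀ q, u q = x0 + t • ∑ q', W q q' • Fn q' (u q')) (q : Q) :
    ‖u q‖ ≤ 2 * (1 + ‖x0‖) := by
  have key : ‖u q‖ ≤ 2 * (‖x0‖ + 1 / 2) := by
    refine le_two_mul_of_le_half_max (x := fun q => ‖u q‖) (fun B hB ⟨q1, hq1⟩ q => ?_) q
    have hB0 : 0 ≤ B := hq1 ▸ norm_nonneg _
    have h1 : ‖∑ q', W q q' • Fn q' (u q')‖ ≤ Fintype.card Q * w * (C * (1 + B)) :=
      norm_sum_smul_le (hW q) (fun q' => (hgrow q' _).trans (by gcongr; exact hB q')) hw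
    have h2 : ‖t • ∑ q', W q q' • Fn q' (u q')‖ ≤ Fintype.card Q * w * (C * (1 + B)) := by
      rw [norm_smul, Real.norm_eq_abs, abs_of_nonneg ht.1]
      exact (mul_le_of_le_one_left (norm_nonneg _) ht.2).trans h1
    have h3 : Fintype.card Q * w * (C * (1 + B)) ≤ 1 / 2 * (1 + B) := by
      rw [← mul_assoc]; gcongr
    calc ‖u q‖ ≤ ‖x0‖ + ‖t • ∑ q', W q q' • Fn q' (u q')‖ := by
          conv_lhs => rw [heq q]
          exact norm_add_le _ _
      _ ≤ B / 2 + (‖x0‖ + 1 / 2) := by linarith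
  linarith

/-- Bounds for the derivatives of the stages along the segment: the derivative of order `i` is
of size `ε ^ i` if the coefficients of the stage equations are of size `ε`. -/
lemma norm_iteratedDerivWithin_stage_le {Fn : Q → E → E} {U : Q → ℝ → E} {W : Q → Q → ℝ}
    {x0 : E} {w ε L A : ℝ} {n : ℕ} {I : Set ℝ} (hI : IsOpen I) (hI1 : I ⊆ Set.Icc 0 1)
    (hw : 0 ≤ w) (hε : 0 ≤ ε) (hε1 : ε ≤ 1) (hL0 : 0 ≤ L) (hA1 : 1 ≤ A)
    (hW : ∀ q q', |W q q'| ≤ w * ε)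
    (hsmall : Fintype.card Q * (w * ε) * L ≤ 1 / 2)
    (hF : ∀ q, ContDiff ℝ n (Fn q)) (hU : ∀ q, ContDiffOn ℝ n (U q) I)
    (heq : ∀ t ∈ I, ∀ q, U q t = x0 + t • ∑ q', W q q' • Fn q' (U q' t))
    (hL : ∀ q x, ‖fderiv ℝ (Fn q) x‖ ≤ L)
    (hA : ∀ t ∈ I, ∀ q, ∀ i ≤ n, ‖iteratedFDeriv ℝ i (Fn q) (U q t)‖ ≤ A)
    {k : ℕ} (hk : k ≤ n) :
    ∀ t ∈ I, ∀ q, ∀ i, 1 ≤ i → i ≤ k → ‖iteratedDerivWithin i (U q) I t‖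
      ≤ (stageConst (2 * (Fintype.card Q * w) + 1) A k * ε) ^ i := by
  have hw1 : 1 ≤ 2 * (Fintype.card Q * w) + 1 := by
    have : 0 ≤ Fintype.card Q * w := by positivity
    linarith
  induction k with
  | zero => intro t _ q i h1 h2; omega
  | succ k ih =>
    intro t ht q i hi1 hik
    have hT1 := one_le_stageConst hw1 hA1 k
    have hT2 := stageConst_le_succ hw1 hA1 k
    have hT3 := one_le_stageConst hw1 hA1 (k + 1)
    rcases Nat.lt_or_ge i (k + 1) with hlt | hge
    · refine (ih (by omega) t ht q i hi1 (by omega)).trans ?_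
      gcongr
    obtain rfl : i = k + 1 := le_antisymm hik hge
    set T := stageConst (2 * (Fintype.card Q * w) + 1) A k with hT
    have hT0 : 0 ≤ T := zero_le_one.trans hT1
    have ih' := ih (by omega)
    have hFk : ∀ q, ContDiff ℝ (k + 1 : ℕ) (Fn q) := fun q => (hF q).of_le (by exact_mod_cast hk)
    have hUk : ∀ q, ContDiffOn ℝ (k + 1 : ℕ) (U q) I := fun q =>
      (hU q).of_le (by exact_mod_cast hk)
    have hFU : ∀ q, ContDiffOn ℝ (k + 1 : ℕ) (fun y => Fn q (U q y)) I := fun q =>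
      (hFk q).comp_contDiffOn (hUk q)
    have hle : ((k : ℕ) : WithTop ℕ∞) ≤ ((k + 1 : ℕ) : WithTop ℕ∞) := by
      exact_mod_cast Nat.le_succ k
    have hsum : ∀ q, ∀ j ≤ k + 1, iteratedDerivWithin j
        (fun y => ∑ q', W q q' • Fn q' (U q' y)) I t
        = ∑ q', W q q' • iteratedDerivWithin j (fun y => Fn q' (U q' y)) I t := by
      intro q j hj
      have hj' : ∀ q', ContDiffWithinAt ℝ j (fun y => Fn q' (U q' y)) I t := fun q' =>
        ((hFU q').of_le (by exact_mod_cast hj)) t ht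
      rw [iteratedDerivWithin_fun_sum ht hI.uniqueDiffOn
        (fun q' _ => (hj' q').const_smul (W q q'))]
      exact Finset.sum_congr rfl fun q' _ =>
        iteratedDerivWithin_fun_const_smul ht hI.uniqueDiffOn _ (hj' q')
    have hform : ∀ q, iteratedDerivWithin (k + 1) (U q) I t
        = t • (∑ q', W q q' • iteratedDerivWithin (k + 1) (fun y => Fn q' (U q' y)) I t)
          + ((k : ℝ) + 1) •
            ∑ q', W q q' • iteratedDerivWithin k (fun y => Fn q' (U q' y)) I t := by
      intro q
      rw [iteratedDerivWithin_congr (g := fun y => x0 + y • ∑ q', W q q' • Fn q' (U q' y))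
        (fun y hy => heq y hy q) ht, iteratedDerivWithin_const_add (Nat.succ_pos k),
        iteratedDerivWithin_succ_id_smul hI
          (ContDiffOn.sum fun q' _ => (hFU q').const_smul (W q q')) t ht,
        hsum q _ le_rfl, hsum q _ (Nat.le_succ k)]
    have hwε : 0 ≤ w * ε := by positivity
    have hb0 : ∀ q, ‖iteratedDerivWithin k (fun y => Fn q (U q y)) I t‖
        ≤ k.factorial * A * (T * ε) ^ k := fun q =>
      norm_iteratedDerivWithin_comp_le hI ((hFk q).of_le hle) ((hUk q).of_le hle) ht
        (fun i hi => hA t ht q i (by omega)) (ih' t ht q)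
    have key : ‖iteratedDerivWithin (k + 1) (U q) I t‖
        ≤ 2 * (Fintype.card Q * w * (2 ^ k * k.factorial + (k + 1) * k.factorial) * A
          * T ^ (k + 1) * ε ^ (k + 1)) := by
      refine le_two_mul_of_le_half_max (x := fun q => ‖iteratedDerivWithin (k + 1) (U q) I t‖)
        (fun B hB ⟨q1, hq1⟩ q => ?_) q
      have hB0 : 0 ≤ B := hq1 ▸ norm_nonneg _
      have hb1 : ∀ q, ‖iteratedDerivWithin (k + 1) (fun y => Fn q (U q y)) I t‖
          ≤ L * B + 2 ^ k * k.factorial * A * (T * ε) ^ (k + 1) := fun q =>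
        (norm_iteratedDerivWithin_succ_comp_le hI (hFk q) (hUk q) ht (by positivity)
          (by positivity) (hL q _) (fun i hi => hA t ht q i (by omega)) (ih' t ht q)).trans
          (by gcongr; exact hB q)
      have h1 := norm_sum_smul_le (hW q) hb1 hwε
      have h2 := norm_sum_smul_le (hW q) hb0 hwε
      have ht' := hI1 ht
      have h3 : ‖iteratedDerivWithin (k + 1) (U q) I t‖
          ≤ Fintype.card Q * (w * ε) * (L * B + 2 ^ k * k.factorial * A * (T * ε) ^ (k + 1))
            + (k + 1) * (Fintype.card Q * (w * ε) * (k.factorial * A * (T * ε) ^ k)) := by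
        rw [hform q]
        refine (norm_add_le _ _).trans (add_le_add ?_ ?_)
        · rw [norm_smul, Real.norm_eq_abs, abs_of_nonneg ht'.1]
          exact (mul_le_of_le_one_left (norm_nonneg _) ht'.2).trans h1
        · rw [norm_smul, Real.norm_eq_abs, abs_of_nonneg (by positivity)]
          gcongr
      have h4 : Fintype.card Q * (w * ε) * (L * B) ≤ B / 2 := by
        rw [← mul_assoc]; nlinarith
      have h5 : Fintype.card Q * (w * ε) * (2 ^ k * k.factorial * A * (T * ε) ^ (k + 1))
          ≤ Fintype.card Q * w * (2 ^ k * k.factorial * A * (T ^ (k + 1) * ε ^ (k + 1))) := by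
        rw [mul_pow]
        have : w * ε ≤ w := mul_le_of_le_one_right hw hε1
        gcongr
      have h6 : (k + 1) * (Fintype.card Q * (w * ε) * (k.factorial * A * (T * ε) ^ k))
          ≤ (k + 1) * (Fintype.card Q * w *
            (k.factorial * A * (T ^ (k + 1) * ε ^ (k + 1)))) := by
        have h7 : T ^ k ≤ T ^ (k + 1) := pow_le_pow_right₀ hT1 (Nat.le_succ k)
        calc _ = (k + 1) * (Fintype.card Q * w *
              (k.factorial * A * (T ^ k * ε ^ (k + 1)))) := by ring
          _ ≤ _ := by gcongr
      calc _ ≤ _ := h3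
        _ ≤ B / 2
            + Fintype.card Q * w * (2 ^ k * k.factorial * A * (T ^ (k + 1) * ε ^ (k + 1)))
            + (k + 1) * (Fintype.card Q * w *
              (k.factorial * A * (T ^ (k + 1) * ε ^ (k + 1)))) := by linarith
        _ = _ := by ring
    refine key.trans ?_
    rw [mul_pow]
    have hself : stageConst (2 * (Fintype.card Q * w) + 1) A (k + 1)
        ≤ stageConst (2 * (Fintype.card Q * w) + 1) A (k + 1) ^ (k + 1) :=
      le_self_pow₀ hT3 (by omega)
    calc _ = (2 * (Fintype.card Q * w)) * (2 ^ k * k.factorial + (k + 1) * k.factorial) * A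
          * T ^ (k + 1) * ε ^ (k + 1) := by ring
      _ ≤ stageConst (2 * (Fintype.card Q * w) + 1) A (k + 1) * ε ^ (k + 1) := by
          rw [stageConst]
          gcongr
          linarith
      _ ≤ _ := by gcongr

lemma exists_uniform_growth {X J : Type} [NormedAddCommGroup X] [Finite J] {φ : J → X → ℝ}
    (h : ∀ j, ∃ K > (0 : ℝ), ∃ r : ℕ, ∀ x, φ j x ≤ K * (1 + ‖x‖ ^ (2 * r))) :
    ∃ K : ℝ, 1 ≤ K ∧ ∃ r : ℕ, ∀ j x, φ j x ≤ K * (1 + ‖x‖) ^ r := by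
  have := Fintype.ofFinite J
  choose K hK r hr using h
  refine ⟨1 + ∑ j, 2 * K j, ?_, ∑ j, 2 * r j, fun j x => (hr j x).trans ?_⟩
  · have : 0 ≤ ∑ j, 2 * K j := Finset.sum_nonneg fun j _ => by have := hK j; positivity
    linarith
  · have h1 : 2 * K j ≤ ∑ j, 2 * K j :=
      Finset.single_le_sum (f := fun j => 2 * K j)
        (fun j _ => by have := hK j; positivity) (Finset.mem_univ j)
    have h2 : 2 * r j ≤ ∑ j, 2 * r j :=
      Finset.single_le_sum (f := fun j => 2 * r j) (fun j _ => Nat.zero_le _) (Finset.mem_univ j)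
    have hx : 1 ≤ 1 + ‖x‖ := by linarith [norm_nonneg x]
    have h3 : ‖x‖ ^ (2 * r j) ≤ (1 + ‖x‖) ^ (2 * r j) := by gcongr; linarith
    have h4 : 1 ≤ (1 + ‖x‖) ^ (2 * r j) := one_le_pow₀ hx
    have hKj := hK j
    calc K j * (1 + ‖x‖ ^ (2 * r j)) ≤ K j * (2 * (1 + ‖x‖) ^ (2 * r j)) := by gcongr; linarith
      _ = 2 * K j * (1 + ‖x‖) ^ (2 * r j) := by ring
      _ ≤ (1 + ∑ j, 2 * K j) * (1 + ‖x‖) ^ (∑ j, 2 * r j) := by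
          gcongr <;> linarith

/-- The derivative of order `n` of a functional of a solution of the stage equations along the
segment is of size `ε ^ n` if the coefficients are of size `ε`. -/
lemma exists_norm_iteratedDerivWithin_functional_le {Fn : Q → E → E} {g : E → F} {n : ℕ}
    {w C L : ℝ} {I : Set ℝ} (hI : IsOpen I) (hI1 : I ⊆ Set.Icc 0 1)
    (hw : 0 ≤ w) (hC : 0 ≤ C) (hL0 : 0 ≤ L)
    (hg : ContDiff ℝ n g) (hF : ∀ q, ContDiff ℝ n (Fn q))
    (hgrow : ∀ q x, ‖Fn q x‖ ≤ C * (1 + ‖x‖)) (hL : ∀ q x, ‖fderiv ℝ (Fn q) x‖ ≤ L)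
    (hpg : ∀ i : ℕ, i ≤ n → ∃ K > (0 : ℝ), ∃ r : ℕ,
      ∀ x, ‖iteratedFDeriv ℝ i g x‖ ≤ K * (1 + ‖x‖ ^ (2 * r)))
    (hpF : ∀ q, ∀ i : ℕ, i ≤ n → ∃ K > (0 : ℝ), ∃ r : ℕ,
      ∀ x, ‖iteratedFDeriv ℝ i (Fn q) x‖ ≤ K * (1 + ‖x‖ ^ (2 * r))) :
    ∃ ε0 > (0 : ℝ), ε0 ≤ 1 ∧ ∃ (K : ℝ) (R : ℕ), ∀ (x0 : E) (ε : ℝ), 0 ≤ ε → ε ≤ ε0 →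
      ∀ (W : Q → Q → ℝ) (U : Q → ℝ → E), (∀ q q', |W q q'| ≤ w * ε) →
        (∀ q, ContDiffOn ℝ n (U q) I) →
        (∀ t ∈ I, ∀ q, U q t = x0 + t • ∑ q', W q q' • Fn q' (U q' t)) →
        ∀ q, ∀ t ∈ I, ‖iteratedDerivWithin n (fun y => g (U q y)) I t‖
          ≤ K * (1 + ‖x0‖) ^ R * ε ^ n := by
  obtain ⟨K1, hK1, r1, hr1⟩ := exists_uniform_growth
    (φ := fun (i : Fin (n + 1)) x => ‖iteratedFDeriv ℝ i g x‖)
    (fun i => hpg i (Nat.lt_succ_iff.1 i.2))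
  obtain ⟨K2, hK2, r2, hr2⟩ := exists_uniform_growth
    (φ := fun (j : Q × Fin (n + 1)) x => ‖iteratedFDeriv ℝ j.2 (Fn j.1) x‖)
    (fun j => hpF j.1 j.2 (Nat.lt_succ_iff.1 j.2.2))
  obtain ⟨c, e, hce⟩ := exists_stageConst_eq (2 * (Fintype.card Q * w) + 1) n
  set N : ℝ := (Fintype.card Q : ℝ) with hN
  have hN0 : 0 ≤ N := Nat.cast_nonneg _
  have hNw : 0 ≤ N * w * (C + L) := by positivity
  refine ⟨1 / (1 + 2 * (N * w * (C + L))), by positivity,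
    (div_le_one (by positivity)).2 (by linarith),
    n.factorial * c ^ n * (K1 * K2 * 3 ^ (r1 + r2)) ^ (1 + e * n),
    (r1 + r2) * (1 + e * n), ?_⟩
  intro x0 ε hε hεle W U hW hU heq q t ht
  have hε' : ε * (1 + 2 * (N * w * (C + L))) ≤ 1 := by
    rwa [le_div_iff₀ (by positivity)] at hεle
  have hε1 : ε ≤ 1 := by nlinarith [mul_nonneg hε hNw]
  have hNwC : 0 ≤ ε * (N * w * C) := by positivity
  have hNwL : 0 ≤ ε * (N * w * L) := by positivity
  have hsC : N * (w * ε) * C ≤ 1 / 2 := by nlinarith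
  have hsL : N * (w * ε) * L ≤ 1 / 2 := by nlinarith
  have hX : 1 ≤ 1 + ‖x0‖ := by linarith [norm_nonneg x0]
  have hX3 : 1 ≤ 3 * (1 + ‖x0‖) := by linarith
  have hUb : ∀ t ∈ I, ∀ q, 1 + ‖U q t‖ ≤ 3 * (1 + ‖x0‖) := by
    intro t ht q
    have := norm_stage_le (hI1 ht) (by positivity) hC hW hsC hgrow (heq t ht) q
    linarith
  have hp1 : 1 ≤ K1 * (3 * (1 + ‖x0‖)) ^ r1 :=
    one_le_mul_of_one_le_of_one_le hK1 (one_le_pow₀ hX3)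
  have hp2 : 1 ≤ K2 * (3 * (1 + ‖x0‖)) ^ r2 :=
    one_le_mul_of_one_le_of_one_le hK2 (one_le_pow₀ hX3)
  set A := (K1 * (3 * (1 + ‖x0‖)) ^ r1) * (K2 * (3 * (1 + ‖x0‖)) ^ r2) with hAdef
  have hA1 : 1 ≤ A := one_le_mul_of_one_le_of_one_le hp1 hp2
  have hgA : ∀ i ≤ n, ‖iteratedFDeriv ℝ i g (U q t)‖ ≤ A := by
    intro i hi
    calc _ ≤ K1 * (1 + ‖U q t‖) ^ r1 := hr1 ⟨i, Nat.lt_succ_iff.2 hi⟩ _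
      _ ≤ K1 * (3 * (1 + ‖x0‖)) ^ r1 := by gcongr; exact hUb t ht q
      _ ≤ A := le_mul_of_one_le_right (by linarith) hp2
  have hFA : ∀ t ∈ I, ∀ q, ∀ i ≤ n, ‖iteratedFDeriv ℝ i (Fn q) (U q t)‖ ≤ A := by
    intro t ht q i hi
    calc _ ≤ K2 * (1 + ‖U q t‖) ^ r2 := hr2 (q, ⟨i, Nat.lt_succ_iff.2 hi⟩) _
      _ ≤ K2 * (3 * (1 + ‖x0‖)) ^ r2 := by gcongr; exact hUb t ht q
      _ ≤ A := le_mul_of_one_le_left (by linarith) hp1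
  have hder := norm_iteratedDerivWithin_stage_le hI hI1 hw hε hε1 hL0 hA1 hW hsL hF hU heq hL hFA
    le_rfl t ht q
  refine (norm_iteratedDerivWithin_comp_le hI hg (hU q) ht hgA hder).trans (le_of_eq ?_)
  rw [← hN, hce, hAdef]
  generalize 1 + ‖x0‖ = X
  ring

/-- The stage index corresponding to an element of `M̄`-style pairs: `none` is `(0,0)`. -/
def pairIdx {m : ℕ} {M : Type} : Option (Fin m × M) → SIdx m M
  | none => .det
  | some (k, ν) => .sto k ν

/-- The coefficients of the stage equations augmented by the one-step value, which is treated as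
an additional stage (index `none`) on which no stage depends. -/
def SRK.augCoeff {m s : ℕ} {M : Type} [Fintype M] (c : SRK m s M) (θ : Mbar M → ℝ) :
    Option (Fin s × Option (Fin m × M)) → Option (Fin s × Option (Fin m × M)) → ℝ
  | _, none => 0
  | none, some (j, κ) => c.z θ (pairIdx κ) j
  | some (i, κ), some (j, κ') => c.Z θ (pairIdx κ) (pairIdx κ') i j

/-- The right-hand sides of the augmented stage equations. -/
def augFun {d m s : ℕ} {M : Type} (a : Evec d → Evec d) (b : Fin m → Evec d → Evec d) :
    Option (Fin s × Option (Fin m × M)) → Evec d → Evec d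
  | none => 0
  | some (_, none) => a
  | some (_, some (k, _)) => b k

/-- The stages augmented by the one-step value. -/
def SRK.augStage {d m s : ℕ} {M : Type} [Fintype M] (c : SRK m s M) (a : Evec d → Evec d)
    (b : Fin m → Evec d → Evec d) (x0 : Evec d) (θ : Mbar M → ℝ)
    (H : SIdx m M → Fin s → Evec d) : Option (Fin s × Option (Fin m × M)) → Evec d
  | none => oneStep c a b x0 θ H
  | some (j, κ) => H (pairIdx κ) j

section Augmented

variable {d m s : ℕ} {M : Type} [Fintype M]

lemma SRK.z_smul (c : SRK m s M) (t : ℝ) (θ : Mbar M → ℝ) (p : SIdx m M) (i : Fin s) :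
    c.z (t • θ) p i = t * c.z θ p i := by
  cases p <;> simp [SRK.z, Finset.mul_sum, mul_left_comm]

lemma SRK.Z_smul (c : SRK m s M) (t : ℝ) (θ : Mbar M → ℝ) (p p' : SIdx m M) (i j : Fin s) :
    c.Z (t • θ) p p' i j = t * c.Z θ p p' i j := by
  cases p' <;> simp [SRK.Z, Finset.mul_sum, mul_left_comm]

lemma abs_sum_mul_le {J : Type} [Fintype J] (u θ : J → ℝ) {ε : ℝ} (h : ∀ j, |θ j| ≤ ε) :
    |∑ j, u j * θ j| ≤ (∑ j, |u j|) * ε := by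
  rw [Finset.sum_mul]
  refine (Finset.abs_sum_le_sum_abs _ _).trans (Finset.sum_le_sum fun j _ => ?_)
  rw [abs_mul]
  exact mul_le_mul_of_nonneg_left (h j) (abs_nonneg _)

lemma SRK.exists_abs_augCoeff_le (c : SRK m s M) :
    ∃ w : ℝ, 0 ≤ w ∧ ∀ (θ : Mbar M → ℝ) (ε : ℝ), (∀ ν, |θ ν| ≤ ε) →
      ∀ q q', |c.augCoeff θ q q'| ≤ w * ε := by
  have h1 : ∀ qq : Option (Fin s × Option (Fin m × M)) × Option (Fin s × Option (Fin m × M)),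
      ∃ w : ℝ, 0 ≤ w ∧ ∀ (θ : Mbar M → ℝ) (ε : ℝ), (∀ ν, |θ ν| ≤ ε) →
        |c.augCoeff θ qq.1 qq.2| ≤ w * ε := by
    rintro ⟨q, q'⟩
    rcases q' with _ | ⟨j, _ | ⟨k, ν⟩⟩
    · exact ⟨0, le_rfl, fun θ ε h => by simp [SRK.augCoeff]⟩
    · rcases q with _ | ⟨i, κ⟩
      · refine ⟨|c.α j|, abs_nonneg _, fun θ ε h => ?_⟩
        simp only [SRK.augCoeff, pairIdx, SRK.z, abs_mul]
        exact mul_le_mul_of_nonneg_left (h _) (abs_nonneg _)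
      · refine ⟨|c.A (pairIdx κ) i j|, abs_nonneg _, fun θ ε h => ?_⟩
        change |c.A (pairIdx κ) i j * θ none| ≤ _
        rw [abs_mul]
        exact mul_le_mul_of_nonneg_left (h _) (abs_nonneg _)
    · rcases q with _ | ⟨i, κ⟩
      · exact ⟨∑ ι, |c.γc ι (.sto k ν) j|, Finset.sum_nonneg fun _ _ => abs_nonneg _,
          fun θ ε h => abs_sum_mul_le _ (fun ι => θ (some ι)) fun ι => h _⟩
      · exact ⟨∑ ι, |c.B ι (pairIdx κ) k ν i j|, Finset.sum_nonneg fun _ _ => abs_nonneg _,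
          fun θ ε h => abs_sum_mul_le _ (fun ι => θ (some ι)) fun ι => h _⟩
  choose w hw0 hw using h1
  refine ⟨∑ qq, w qq, Finset.sum_nonneg fun qq _ => hw0 qq, fun θ ε h q q' => ?_⟩
  have hε : 0 ≤ ε := (abs_nonneg _).trans (h none)
  refine (hw (q, q') θ ε h).trans (mul_le_mul_of_nonneg_right ?_ hε)
  exact Finset.single_le_sum (fun qq _ => hw0 qq) (Finset.mem_univ (q, q'))

lemma SRK.augStage_none_eq (c : SRK m s M) (a : Evec d → Evec d) (b : Fin m → Evec d → Evec d)
    (x0 : Evec d) (t : ℝ) (θ : Mbar M → ℝ) (H : SIdx m M → Fin s → Evec d) :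
    c.augStage a b x0 (t • θ) H none = x0 + t • ∑ q', c.augCoeff θ none q' •
      augFun a b q' (c.augStage a b x0 (t • θ) H q') := by
  simp only [SRK.augStage, oneStep, SRK.z_smul, Fintype.sum_option, SRK.augCoeff, zero_smul,
    zero_add, Fintype.sum_prod_type, augFun, pairIdx, Finset.sum_add_distrib, smul_add,
    Finset.smul_sum, mul_smul, add_assoc]

lemma SRK.augStage_some_eq {c : SRK m s M} {a : Evec d → Evec d} {b : Fin m → Evec d → Evec d}
    {x0 : Evec d} {t : ℝ} {θ : Mbar M → ℝ} {H : SIdx m M → Fin s → Evec d}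
    (hH : StageEq c a b x0 (t • θ) H) (i : Fin s) (κ : Option (Fin m × M)) :
    c.augStage a b x0 (t • θ) H (some (i, κ)) = x0 + t • ∑ q', c.augCoeff θ (some (i, κ)) q' •
      augFun a b q' (c.augStage a b x0 (t • θ) H q') := by
  have h := hH (pairIdx κ) i
  simp only [SRK.Z_smul] at h
  simpa only [SRK.augStage, Fintype.sum_option, SRK.augCoeff, zero_smul,
    zero_add, Fintype.sum_prod_type, augFun, pairIdx, Finset.sum_add_distrib, smul_add,
    Finset.smul_sum, mul_smul, add_assoc] using h

lemma smul_mem_segment_zero {t : ℝ} (ht : t ∈ Set.Icc (0 : ℝ) 1) (v : E) :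
    t • v ∈ segment ℝ 0 v :=
  ⟨1 - t, t, by linarith [ht.2], ht.1, by ring, by simp⟩

/-- Deterministic estimate of the derivative of order `n` of `f ∘ A` in direction `Δ` at a point
of the segment joining `0` and `Δ`. -/
lemma SRK.exists_abs_iteratedFDeriv_oneStep_le (c : SRK m s M) (n : ℕ)
    {f : Evec d → ℝ} {a : Evec d → Evec d} {b : Fin m → Evec d → Evec d} {C L : ℝ}
    (hC : 0 ≤ C) (hL : 0 ≤ L) (hf : IsCP n f)
    (hsa : ContDiff ℝ n a) (hsb : ∀ k, ContDiff ℝ n (b k))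
    (hgrowa : ∀ x, ‖a x‖ ≤ C * (1 + ‖x‖)) (hgrowb : ∀ k x, ‖b k x‖ ≤ C * (1 + ‖x‖))
    (hdera : ∀ x, ‖fderiv ℝ a x‖ ≤ L) (hderb : ∀ k x, ‖fderiv ℝ (b k) x‖ ≤ L)
    (hpolya : ∀ i : ℕ, i ≤ n → ∃ K > (0:ℝ), ∃ r : ℕ,
      ∀ x, ‖iteratedFDeriv ℝ i a x‖ ≤ K * (1 + ‖x‖^(2*r)))
    (hpolyb : ∀ (k : Fin m) (i : ℕ), i ≤ n → ∃ K > (0:ℝ), ∃ r : ℕ,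
      ∀ x, ‖iteratedFDeriv ℝ i (b k) x‖ ≤ K * (1 + ‖x‖^(2*r))) :
    ∃ ε0 > (0 : ℝ), ε0 ≤ 1 ∧ ∃ (K : ℝ) (R : ℕ), ∀ (x0 : Evec d) (ε : ℝ), ε ≤ ε0 →
      ∀ (Δ : Mbar M → ℝ), (∀ ν, |Δ ν| ≤ ε) →
      ∀ H : (Mbar M → ℝ) → SIdx m M → Fin s → Evec d,
        (∀ p i, ContDiffOn ℝ n (fun θ => H θ p i) (segment ℝ 0 Δ)) →
        (∀ θ ∈ segment ℝ 0 Δ, StageEq c a b x0 θ (H θ)) →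
        ∀ t ∈ Set.Ioo (0 : ℝ) 1,
          |iteratedFDeriv ℝ n (fun θ => f (oneStep c a b x0 θ (H θ))) (t • Δ) (fun _ => Δ)|
            ≤ |K| * (1 + ‖x0‖) ^ R * ε ^ n := by
  obtain ⟨w, hw, hW⟩ := c.exists_abs_augCoeff_le
  have hI : IsOpen (Set.Ioo (0 : ℝ) 1) := isOpen_Ioo
  have hF : ∀ q, ContDiff ℝ n (augFun (s := s) (M := M) a b q) := by
    rintro (_ | ⟨i, _ | ⟨k, ν⟩⟩)
    exacts [contDiff_const, hsa, hsb k]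
  obtain ⟨ε0, hε0, hε01, K, R, hmain⟩ := exists_norm_iteratedDerivWithin_functional_le
    (Fn := augFun (s := s) (M := M) a b) hI Set.Ioo_subset_Icc_self hw hC hL hf.1 hF
    (by
      rintro (_ | ⟨i, _ | ⟨k, ν⟩⟩) x
      exacts [by simpa [augFun] using by positivity, hgrowa x, hgrowb k x])
    (by
      rintro (_ | ⟨i, _ | ⟨k, ν⟩⟩) x
      exacts [by simpa [augFun] using hL, hdera x, hderb k x])
    hf.2
    (by
      rintro (_ | ⟨i, _ | ⟨k, ν⟩⟩) j hj
      exacts [⟨1, one_pos, 0, fun x => by simp [augFun]⟩, hpolya j hj, hpolyb k j hj])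
  refine ⟨ε0, hε0, hε01, K, R, fun x0 ε hε Δ hΔ H hH hSt t ht => ?_⟩
  have hεn : 0 ≤ ε := (abs_nonneg _).trans (hΔ none)
  have hseg : ∀ t ∈ Set.Ioo (0 : ℝ) 1, t • Δ ∈ segment ℝ 0 Δ := fun t ht =>
    smul_mem_segment_zero (Set.Ioo_subset_Icc_self ht) Δ
  have heq : ∀ t ∈ Set.Ioo (0 : ℝ) 1, ∀ q, c.augStage a b x0 (t • Δ) (H (t • Δ)) q
      = x0 + t • ∑ q', c.augCoeff Δ q q' •
        augFun a b q' (c.augStage a b x0 (t • Δ) (H (t • Δ)) q') := by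
    rintro t ht (_ | ⟨i, κ⟩)
    · exact c.augStage_none_eq a b x0 t Δ _
    · exact SRK.augStage_some_eq (hSt _ (hseg t ht)) i κ
  have hsome : ∀ i κ, ContDiffOn ℝ n
      (fun t : ℝ => c.augStage a b x0 (t • Δ) (H (t • Δ)) (some (i, κ))) (Set.Ioo 0 1) :=
    fun i κ => (hH (pairIdx κ) i).comp (contDiff_id.smul contDiff_const).contDiffOn hseg
  have hnone : ContDiffOn ℝ n
      (fun t : ℝ => c.augStage a b x0 (t • Δ) (H (t • Δ)) none) (Set.Ioo 0 1) := by
    refine ContDiffOn.congr (f := fun t : ℝ => x0 + t • ∑ q', c.augCoeff Δ none q' •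
      augFun a b q' (c.augStage a b x0 (t • Δ) (H (t • Δ)) q')) ?_ (fun t ht => heq t ht none)
    refine contDiffOn_const.add (contDiffOn_id.smul (ContDiffOn.sum fun q' _ => ?_))
    rcases q' with _ | ⟨i, κ⟩
    · simpa [augFun] using contDiffOn_const
    · exact ((hF _).comp_contDiffOn (hsome i κ)).const_smul _
  have hU : ∀ q, ContDiffOn ℝ n
      (fun t : ℝ => c.augStage a b x0 (t • Δ) (H (t • Δ)) q) (Set.Ioo 0 1) := by
    rintro (_ | ⟨i, κ⟩)
    exacts [hnone, hsome i κ]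
  have hbound := hmain x0 ε hεn hε (c.augCoeff Δ)
    (fun q t => c.augStage a b x0 (t • Δ) (H (t • Δ)) q) (hW Δ ε hΔ) hU heq none t ht
  rcases iteratedFDeriv_diag_eq_or_eq_zero (fun θ => f (oneStep c a b x0 θ (H θ))) Δ hI
    (hf.1.comp_contDiffOn hnone) le_rfl t ht with h | h
  · rw [h, ← Real.norm_eq_abs]
    refine hbound.trans ?_
    gcongr
    exact le_abs_self K
  · rw [h, abs_zero]
    positivity

end Augmented

end RemainderAux

/-- Estimate of the expected Taylor remainder of the SRK approximation:
`|E(D^{2p+2}(f∘A)(ξ·θ(h)))| ≤ K(x_0)·h^{p+1}` with `K ∈ C_P^0`. -/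
theorem srk_expected_remainder_bound
    (d m s p : ℕ) (M : Type) [Fintype M] [DecidableEq M]
    (c : SRK m s M)
    (f : Evec d → ℝ) (a : Evec d → Evec d) (b : Fin m → Evec d → Evec d)
    (C1 L Cϑ : ℝ) (hC1 : 0 < C1) (hL : 0 ≤ L) (hCϑ : 0 < Cϑ)
    (hf : IsCP (2*p+2) f)
    (hsa : ContDiff ℝ (2*p+2) a) (hsb : ∀ k, ContDiff ℝ (2*p+2) (b k))
    (hgrowa : ∀ x, ‖a x‖ ≤ C1 * (1 + ‖x‖)) (hgrowb : ∀ k x, ‖b k x‖ ≤ C1 * (1 + ‖x‖))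
    (hdera : ∀ x, ‖fderiv ℝ a x‖ ≤ L) (hderb : ∀ k x, ‖fderiv ℝ (b k) x‖ ≤ L)
    (hpolya : ∀ i : ℕ, i ≤ 2*p+2 → ∃ K > (0:ℝ), ∃ r : ℕ,
      ∀ x, ‖iteratedFDeriv ℝ i a x‖ ≤ K * (1 + ‖x‖^(2*r)))
    (hpolyb : ∀ (k : Fin m) (i : ℕ), i ≤ 2*p+2 → ∃ K > (0:ℝ), ∃ r : ℕ,
      ∀ x, ‖iteratedFDeriv ℝ i (b k) x‖ ≤ K * (1 + ‖x‖^(2*r)))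
    (Ω : Type) [MeasurableSpace Ω] (P : Measure Ω) [IsProbabilityMeasure P]
    (ϑ : M → Ω → ℝ) (hϑm : ∀ ι, Measurable (ϑ ι))
    (hϑb : ∀ᵐ ω ∂P, ∀ ι : M, |ϑ ι ω| ≤ Cϑ) :
    ∃ h0 > (0:ℝ), ∃ K : Evec d → ℝ,
      (Continuous K ∧ ∃ Kc > (0:ℝ), ∃ r : ℕ, ∀ x, |K x| ≤ Kc * (1 + ‖x‖^(2*r)))
      ∧ ∀ (x0 : Evec d) (h : ℝ), 0 < h → h < h0 →
        ∀ ξ : Ω → ℝ, (∀ᵐ ω ∂P, ξ ω ∈ Set.Ioo (0:ℝ) 1) →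
        ∀ H : Ω → (Mbar M → ℝ) → SIdx m M → Fin s → Evec d,
          (∀ᵐ ω ∂P,
            (∀ (pp : SIdx m M) (i : Fin s),
              ContDiffOn ℝ (2*p+2) (fun θ => H ω θ pp i)
                (segment ℝ 0 (fun ν => Option.elim ν h (fun ι => Real.sqrt h * ϑ ι ω))))
            ∧ ∀ θ ∈ segment ℝ 0 (fun ν => Option.elim ν h (fun ι => Real.sqrt h * ϑ ι ω)),
                StageEq c a b x0 θ (H ω θ)) →
          |∫ ω, ∑ νs : Fin (2*p+2) → Mbar M,
              (∏ r, Option.elim (νs r) h (fun ι => Real.sqrt h * ϑ ι ω)) *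
                iteratedFDeriv ℝ (2*p+2) (fun θ => f (oneStep c a b x0 θ (H ω θ)))
                  (ξ ω • fun ν => Option.elim ν h (fun ι => Real.sqrt h * ϑ ι ω))
                  (fun r => Pi.single (νs r) 1) ∂P|
            ≤ K x0 * h^(p+1) := by
  have hn : ((2 * p + 2 : ℕ) : WithTop ℕ∞) = 2 * (p : WithTop ℕ∞) + 2 := by push_cast; rfl
  obtain ⟨ε0, hε0, hε01, K, R, hmain⟩ := c.exists_abs_iteratedFDeriv_oneStep_le (2 * p + 2)
    hC1.le hL hf (hn ▸ hsa) (fun k => hn ▸ hsb k) hgrowa hgrowb hdera hderb hpolya hpolyb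
  have hD : 0 < 1 + Cϑ := by positivity
  refine ⟨(ε0 / (1 + Cϑ)) ^ 2, by positivity,
    fun x => |K| * (1 + Cϑ) ^ (2 * p + 2) * (1 + ‖x‖) ^ R, ⟨by fun_prop, ?_⟩, ?_⟩
  · refine ⟨(|K| + 1) * (1 + Cϑ) ^ (2 * p + 2) * 2 ^ (2 * R), by positivity, R, fun x => ?_⟩
    have hx : 1 ≤ 1 + ‖x‖ := by linarith [norm_nonneg x]
    have h1 : (1 + ‖x‖) ^ R ≤ 2 ^ (2 * R) * (1 + ‖x‖ ^ (2 * R)) := by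
      calc (1 + ‖x‖) ^ R ≤ (1 + ‖x‖) ^ (2 * R) := pow_le_pow_right₀ hx (by omega)
        _ ≤ 2 ^ (2 * R - 1) * (1 ^ (2 * R) + ‖x‖ ^ (2 * R)) :=
            add_pow_le zero_le_one (norm_nonneg x) _
        _ ≤ 2 ^ (2 * R) * (1 + ‖x‖ ^ (2 * R)) := by
            rw [one_pow]
            exact mul_le_mul_of_nonneg_right
              (pow_le_pow_right₀ one_le_two (Nat.sub_le _ _)) (by positivity)
    rw [abs_of_nonneg (by positivity)]
    calc |K| * (1 + Cϑ) ^ (2 * p + 2) * (1 + ‖x‖) ^ R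
        ≤ (|K| + 1) * (1 + Cϑ) ^ (2 * p + 2) * (2 ^ (2 * R) * (1 + ‖x‖ ^ (2 * R))) := by
          gcongr
          linarith
      _ = _ := by ring
  intro x0 h hh hh0 ξ hξ H hH
  have hsq : Real.sqrt h < ε0 / (1 + Cϑ) := by
    rw [Real.sqrt_lt' (by positivity)]
    exact hh0
  have hε : (1 + Cϑ) * Real.sqrt h ≤ ε0 := by
    rw [lt_div_iff₀ hD] at hsq
    linarith
  have hs0 : 0 ≤ Real.sqrt h := Real.sqrt_nonneg h
  have hs1 : Real.sqrt h ≤ 1 := by nlinarith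
  have hss : Real.sqrt h * Real.sqrt h = h := Real.mul_self_sqrt hh.le
  have hpow : ((1 + Cϑ) * Real.sqrt h) ^ (2 * p + 2)
      = (1 + Cϑ) ^ (2 * p + 2) * h ^ (p + 1) := by
    rw [mul_pow, show 2 * p + 2 = 2 * (p + 1) by ring, pow_mul (Real.sqrt h), Real.sq_sqrt hh.le]
  rw [← Real.norm_eq_abs]
  have hae : ∀ᵐ ω ∂P, ‖∑ νs : Fin (2*p+2) → Mbar M,
      (∏ r, Option.elim (νs r) h (fun ι => Real.sqrt h * ϑ ι ω)) *
        iteratedFDeriv ℝ (2*p+2) (fun θ => f (oneStep c a b x0 θ (H ω θ)))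
          (ξ ω • fun ν => Option.elim ν h (fun ι => Real.sqrt h * ϑ ι ω))
          (fun r => Pi.single (νs r) 1)‖
      ≤ |K| * (1 + Cϑ) ^ (2 * p + 2) * (1 + ‖x0‖) ^ R * h ^ (p + 1) := by
    filter_upwards [hξ, hH, hϑb] with ω h1 h2 h3
    rw [iteratedFDeriv_diag_eq_sum (2 * p + 2)
      (fun ν => Option.elim ν h (fun ι => Real.sqrt h * ϑ ι ω)), Real.norm_eq_abs]
    refine (hmain x0 _ hε _ ?_ (H ω) (fun pp i => hn ▸ h2.1 pp i) h2.2 (ξ ω) h1).trans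
      (le_of_eq ?_)
    · rintro (_ | ι)
      · simp only [Option.elim_none]
        rw [abs_of_pos hh]
        nlinarith [mul_nonneg hCϑ.le hs0]
      · simp only [Option.elim_some]
        rw [abs_mul, abs_of_nonneg hs0, mul_comm]
        refine mul_le_mul_of_nonneg_right ?_ hs0
        linarith [h3 ι]
    · rw [hpow]
      ring
  simpa using norm_integral_le_of_norm_le_const hae

end SRKPaper
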